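/- There exist universal constants δ > 0 and C > 0 such that for all ε and λ with 0 < ε < 1/2 and λ_c ≤ λ < δ|log ε|, one has F_{ε,λ}[m] ≥ −C · λ ε^{(λ_c − λ)/λ} / |log ε| for every m ∈ H¹(𝕋²; S²). -/

import Mathlib

open MeasureTheory Real Filter

noncomputable section

/-- The plane `ℝ²`, modeled as functions `Fin 2 → ℝ`. -/
abbrev R2 : Type := Fin 2 → ℝ

/-- The target space `ℝ³`. -/
abbrev R3 : Type := Fin 3 → ℝ

/-- A fundamental domain for the unit torus `𝕋² = ℝ²/ℤ²`. -/
def cube : Set R2 := Set.univ.pi fun _ => Set.Ico (0 : ℝ) 1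

/-- The Euclidean norm on `ℝ²`. -/
def en2 (z : R2) : ℝ := Real.sqrt (∑ i, z i ^ 2)

/-- The Euclidean norm on `ℝ³`. -/
def en3 (v : R3) : ℝ := Real.sqrt (∑ i, v i ^ 2)

/-- `|∇f(x)|²` for a scalar function. -/
def gradNormSq (f : R2 → ℝ) (x : R2) : ℝ :=
  ∑ j, (fderiv ℝ f x (Pi.single j 1)) ^ 2

/-- `|∇f(x)|` for a scalar function. -/
def gradNorm (f : R2 → ℝ) (x : R2) : ℝ := Real.sqrt (gradNormSq f x)

/-- `|∇m(x)|²` for a map `m : ℝ² → ℝ³` (Frobenius norm squared). -/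
def gradVSq (m : R2 → R3) (x : R2) : ℝ :=
  ∑ j, ∑ i, (fderiv ℝ m x (Pi.single j 1) i) ^ 2

/-- The squared homogeneous `H^{1/2}` seminorm on the torus (real-space formula). -/
def H12 (f : R2 → ℝ) : ℝ :=
  (1 / (4 * π)) * ∫ x in cube, ∫ z : R2, (f (x + z) - f x) ^ 2 / en2 z ^ 3

/-- A (strong) magnetization in `H¹(𝕋²; S²)`: a continuously differentiable
`ℤ²`-periodic map with values in the unit sphere `S² ⊂ ℝ³`. -/
def Mag (m : R2 → R3) : Prop :=
  ContDiff ℝ 1 m ∧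
    (∀ (x : R2) (n : Fin 2 → ℤ), m (x + fun i => (n i : ℝ)) = m x) ∧
    ∀ x, ∑ i, (m x i) ^ 2 = 1

/-- The reduced thin-film energy `F_{ε,λ}`. -/
def Fen (ε lam : ℝ) (m : R2 → R3) : ℝ :=
  (∫ x in cube, (ε / 2 * gradVSq m x + (1 - (m x 2) ^ 2) / (2 * ε)))
    - lam / |Real.log ε| * H12 (fun x => m x 2)

/-- The north pole `e₃ = (0,0,1)`. -/
def e3 : R3 := ![0, 0, 1]

/-! ### Translation invariance of integrals of periodic functions -/

theorem cube_eq : cube = ZSpan.fundamentalDomain (Pi.basisFun ℝ (Fin 2)) := by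
  rw [ZSpan.fundamentalDomain_pi_basisFun]; rfl

theorem measurableSet_cube : MeasurableSet cube :=
  MeasurableSet.univ_pi fun _ => measurableSet_Ico

theorem volume_cube : volume cube = 1 := by
  rw [cube, Real.volume_pi_Ico]
  simp

theorem lintegral_cube_shift (h : R2 → ENNReal)
    (hp : ∀ (x : R2) (n : Fin 2 → ℤ), h (x + fun i => (n i : ℝ)) = h x) (w : R2) :
    ∫⁻ x in cube, h (x + w) = ∫⁻ x in cube, h x := by
  have h0 := ZSpan.isAddFundamentalDomain' (Pi.basisFun ℝ (Fin 2)) volume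
  rw [← cube_eq] at h0
  have : Countable (Submodule.span ℤ (Set.range (Pi.basisFun ℝ (Fin 2)))).toAddSubgroup := by
    change Countable (Submodule.span ℤ (Set.range (Pi.basisFun ℝ (Fin 2))))
    infer_instance
  have h1 := h0.vadd_of_comm w
  have hinv : ∀ (g : (Submodule.span ℤ (Set.range (Pi.basisFun ℝ (Fin 2)))).toAddSubgroup) (x : R2),
      h (g +ᵥ x) = h x := by
    rintro ⟨g, hg⟩ x
    have hg' := (Module.Basis.mem_span_iff_repr_mem ℤ (Pi.basisFun ℝ (Fin 2)) g).1 hg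
    choose n hn using hg'
    have : g = fun i => (n i : ℝ) := by
      ext i
      have := hn i
      simpa using this.symm
    change h (g + x) = h x
    rw [this, add_comm, hp]
  rw [h0.setLIntegral_eq h1 h hinv]
  have e : Set.image (HVAdd.hVAdd w) cube = Set.image (fun x => x + w) cube := by
    refine Set.image_congr fun y _ => ?_
    rw [vadd_eq_add, add_comm]
  rw [show ∫⁻ x in cube, h (x + w) = ∫⁻ x in Set.image (fun x => x + w) cube, h x from ?_, ← e]
  · rfl
  · exact ((measurePreserving_add_right volume w).setLIntegral_comp_emb
      (measurableEmbedding_addRight w) h cube)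

/-! ### Polar coordinates -/

theorem lintegral_polar_le (h : R2 → ENNReal) (φ ψ : ℝ → ENNReal)
    (hφ : Measurable φ) (hψ : Measurable ψ)
    (hle : ∀ ρ θ : ℝ, 0 < ρ →
      ENNReal.ofReal ρ * h ![ρ * Real.cos θ, ρ * Real.sin θ] ≤ φ ρ * ψ θ) :
    ∫⁻ z, h z ≤ (∫⁻ ρ in Set.Ioi 0, φ ρ) * ∫⁻ θ in Set.Ioo (-π) π, ψ θ := by
  have e : ∫⁻ z, h z = ∫⁻ p : ℝ × ℝ, h ![p.1, p.2] := by
    rw [← ((volume_preserving_finTwoArrow ℝ).symm _).lintegral_comp_emb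
      (MeasurableEquiv.measurableEmbedding _)]
    rfl
  rw [e, ← lintegral_comp_polarCoord_symm, ← lintegral_prod_mul hφ.aemeasurable hψ.aemeasurable,
    Measure.prod_restrict]
  refine setLIntegral_mono (by fun_prop) ?_
  rintro ⟨ρ, θ⟩ ⟨hρ, -⟩
  simpa using hle ρ θ hρ

theorem en2_polar (ρ θ : ℝ) (hρ : 0 < ρ) : en2 ![ρ * Real.cos θ, ρ * Real.sin θ] = ρ := by
  have : ρ ^ 2 = ∑ i, (![ρ * Real.cos θ, ρ * Real.sin θ] : R2) i ^ 2 := by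
    simp [mul_pow]
    rw [← mul_add, Real.cos_sq_add_sin_sq, mul_one]
  rw [en2, ← this, Real.sqrt_sq hρ.le]

theorem integral_abs_cos_full (t : ℝ) : ∫ θ in t..t + 2 * π, |Real.cos θ| = 4 := by
  have hp : Function.Periodic (fun θ => |Real.cos θ|) π := fun x => by simp
  have h1 : ∫ θ in (-(π / 2))..(π / 2), |Real.cos θ| = 2 := by
    rw [intervalIntegral.integral_congr (g := Real.cos)]
    · rw [integral_cos]; simp; norm_num
    · intro θ hθ
      rw [Set.uIcc_of_le (by linarith [Real.pi_pos])] at hθ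
      exact abs_of_nonneg (Real.cos_nonneg_of_mem_Icc hθ)
  have h2 : ∀ s : ℝ, ∫ θ in s..s + π, |Real.cos θ| = 2 := by
    intro s
    rw [hp.intervalIntegral_add_eq s (-(π / 2)), show -(π / 2) + π = π / 2 by ring, h1]
  have hc : Continuous fun θ : ℝ => |Real.cos θ| := by fun_prop
  rw [← intervalIntegral.integral_add_adjacent_intervals (b := t + π)
    (hc.intervalIntegrable _ _) (hc.intervalIntegrable _ _), h2]
  have := h2 (t + π)
  rw [show t + π + π = t + 2 * π by ring] at this
  rw [this]; norm_num

theorem integral_abs_trig (a b : ℝ) :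
    ∫ θ in (-π)..π, |a * Real.cos θ + b * Real.sin θ| = 4 * Real.sqrt (a ^ 2 + b ^ 2) := by
  obtain ⟨ρ, φ, h0, ha, hb⟩ : ∃ ρ φ : ℝ, 0 ≤ ρ ∧ a = ρ * Real.cos φ ∧ b = ρ * Real.sin φ := by
    refine ⟨‖(⟨a, b⟩ : ℂ)‖, Complex.arg ⟨a, b⟩, norm_nonneg _, ?_, ?_⟩
    · rw [Complex.norm_mul_cos_arg]
    · rw [Complex.norm_mul_sin_arg]
  have e : a ^ 2 + b ^ 2 = ρ ^ 2 := by
    rw [ha, hb, mul_pow, mul_pow, ← mul_add, Real.cos_sq_add_sin_sq, mul_one]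
  rw [e, Real.sqrt_sq h0]
  have : ∀ θ, |a * Real.cos θ + b * Real.sin θ| = ρ * |Real.cos (θ - φ)| := by
    intro θ
    rw [show a * Real.cos θ + b * Real.sin θ = ρ * Real.cos (θ - φ) by
      rw [Real.cos_sub, ha, hb]; ring, abs_mul, abs_of_nonneg h0]
  simp_rw [this]
  rw [intervalIntegral.integral_const_mul,
    intervalIntegral.integral_comp_sub_right (fun θ => |Real.cos θ|)]
  have := integral_abs_cos_full (-π - φ)
  rw [show -π - φ + 2 * π = π - φ by ring] at this
  rw [this]; ring

theorem integral_sq_trig (a b : ℝ) :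
    ∫ θ in (-π)..π, (a * Real.cos θ + b * Real.sin θ) ^ 2 = π * (a ^ 2 + b ^ 2) := by
  have : ∀ θ, (a * Real.cos θ + b * Real.sin θ) ^ 2 =
      a ^ 2 * Real.cos θ ^ 2 + 2 * a * b * (Real.sin θ * Real.cos θ) + b ^ 2 * Real.sin θ ^ 2 := by
    intro θ; ring
  simp_rw [this]
  rw [intervalIntegral.integral_add, intervalIntegral.integral_add,
    intervalIntegral.integral_const_mul, intervalIntegral.integral_const_mul,
    intervalIntegral.integral_const_mul, integral_cos_sq, integral_sin_sq, integral_sin_mul_cos₁]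
  · simp; ring
  all_goals exact Continuous.intervalIntegrable (by fun_prop) _ _

theorem lintegral_Ioo_eq (g : ℝ → ℝ) (hg : Continuous g) (h0 : ∀ x, 0 ≤ g x) :
    ∫⁻ θ in Set.Ioo (-π) π, ENNReal.ofReal (g θ) = ENNReal.ofReal (∫ θ in (-π)..π, g θ) := by
  rw [intervalIntegral.integral_of_le (by linarith [Real.pi_pos]), integral_Ioc_eq_integral_Ioo,
    ofReal_integral_eq_lintegral_ofReal]
  · exact (hg.integrableOn_Icc (a := -π) (b := π)).mono_set Set.Ioo_subset_Icc_self
  · exact Eventually.of_forall h0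

/-! ### Kernel integrals -/

theorem continuous_en2 : Continuous en2 := by
  unfold en2; fun_prop

/-- The kernel `|z|⁻³` restricted to a set of radii. -/
def kern (s : Set ℝ) (z : R2) : ENNReal :=
  s.indicator (fun ρ => ENNReal.ofReal (1 / ρ ^ 3)) (en2 z)

theorem measurable_kern (s : Set ℝ) (hs : MeasurableSet s) : Measurable (kern s) := by
  have : Measurable (s.indicator (fun ρ : ℝ => ENNReal.ofReal (1 / ρ ^ 3))) :=
    Measurable.indicator (by fun_prop) hs
  exact this.comp continuous_en2.measurable

theorem kern_short (r : ℝ) (hr : 0 < r) (a b : ℝ) :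
    ∫⁻ z, kern (Set.Iio r) z * ENNReal.ofReal ((a * z 0 + b * z 1) ^ 2)
      ≤ ENNReal.ofReal (π * r * (a ^ 2 + b ^ 2)) := by
  refine (lintegral_polar_le _ ((Set.Iio r).indicator 1)
    (fun θ => ENNReal.ofReal ((a * Real.cos θ + b * Real.sin θ) ^ 2))
    (measurable_one.indicator measurableSet_Iio) (by fun_prop) ?_).trans ?_
  · intro ρ θ hρ
    rw [kern, en2_polar ρ θ hρ]
    by_cases h : ρ ∈ Set.Iio r
    · rw [Set.indicator_of_mem h, Set.indicator_of_mem h, ← ENNReal.ofReal_mul (by positivity),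
        ← ENNReal.ofReal_mul (by positivity), Pi.one_apply, one_mul]
      apply ENNReal.ofReal_le_ofReal
      apply le_of_eq
      simp
      field_simp
    · simp [h]
  · rw [lintegral_Ioo_eq _ (by fun_prop) (fun x => sq_nonneg _), integral_sq_trig,
      lintegral_indicator_one measurableSet_Iio,
      Measure.restrict_apply measurableSet_Iio, Set.inter_comm, Set.Ioi_inter_Iio,
      Real.volume_Ioo, ← ENNReal.ofReal_mul (by linarith)]
    apply ENNReal.ofReal_le_ofReal
    apply le_of_eq
    ring

theorem kern_mid (r R : ℝ) (hr : 0 < r) (hR : r ≤ R) (a b : ℝ) :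
    ∫⁻ z, kern (Set.Ico r R) z * ENNReal.ofReal |a * z 0 + b * z 1|
      ≤ ENNReal.ofReal (4 * Real.log (R / r) * Real.sqrt (a ^ 2 + b ^ 2)) := by
  refine (lintegral_polar_le _ ((Set.Ico r R).indicator (fun ρ => ENNReal.ofReal (1 / ρ)))
    (fun θ => ENNReal.ofReal |a * Real.cos θ + b * Real.sin θ|)
    (Measurable.indicator (by fun_prop) measurableSet_Ico) (by fun_prop) ?_).trans ?_
  · intro ρ θ hρ
    rw [kern, en2_polar ρ θ hρ]
    by_cases h : ρ ∈ Set.Ico r R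
    · rw [Set.indicator_of_mem h, Set.indicator_of_mem h, ← ENNReal.ofReal_mul (by positivity),
        ← ENNReal.ofReal_mul (by positivity), ← ENNReal.ofReal_mul (by positivity)]
      apply ENNReal.ofReal_le_ofReal
      apply le_of_eq
      simp only [Matrix.cons_val_zero, Matrix.cons_val_one]
      rw [show a * (ρ * Real.cos θ) + b * (ρ * Real.sin θ)
        = ρ * (a * Real.cos θ + b * Real.sin θ) by ring, abs_mul, abs_of_pos hρ]
      field_simp
    · simp [h]
  · have hsub : Set.Ico r R ⊆ Set.Ioi 0 := fun x hx => hr.trans_le hx.1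
    have hl : 0 ≤ Real.log (R / r) := Real.log_nonneg (by rw [le_div_iff₀ hr]; linarith)
    have e : ∫⁻ ρ in Set.Ioi 0, (Set.Ico r R).indicator (fun ρ => ENNReal.ofReal (1 / ρ)) ρ
        = ENNReal.ofReal (Real.log (R / r)) := by
      rw [lintegral_indicator measurableSet_Ico, Measure.restrict_restrict measurableSet_Ico,
        Set.inter_eq_self_of_subset_left hsub,
        ← integral_one_div_of_pos hr (hr.trans_le hR),
        intervalIntegral.integral_of_le hR, integral_Ioc_eq_integral_Ioo,
        ← integral_Ico_eq_integral_Ioo, ofReal_integral_eq_lintegral_ofReal]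
      · have : ContinuousOn (fun x : ℝ => 1 / x) (Set.Icc r R) :=
          continuousOn_const.div continuousOn_id (fun x hx => (hr.trans_le hx.1).ne')
        exact (this.integrableOn_Icc).mono_set Set.Ico_subset_Icc_self
      · filter_upwards [ae_restrict_mem measurableSet_Ico] with x hx
        have := hr.trans_le hx.1
        simp only [Pi.zero_apply]
        positivity
    rw [e, lintegral_Ioo_eq _ (by fun_prop) (fun x => abs_nonneg _), integral_abs_trig,
      ← ENNReal.ofReal_mul hl]
    apply ENNReal.ofReal_le_ofReal
    apply le_of_eq
    ring

theorem kern_long (R : ℝ) (hR : 0 < R) :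
    ∫⁻ z, kern (Set.Ici R) z ≤ ENNReal.ofReal (2 * π / R) := by
  refine (lintegral_polar_le _ ((Set.Ici R).indicator (fun ρ => ENNReal.ofReal (ρ ^ (-2 : ℝ))))
    (fun θ => 1)
    (Measurable.indicator (by fun_prop) measurableSet_Ici) (by fun_prop) ?_).trans ?_
  · intro ρ θ hρ
    rw [kern, en2_polar ρ θ hρ]
    by_cases h : ρ ∈ Set.Ici R
    · rw [Set.indicator_of_mem h, Set.indicator_of_mem h, ← ENNReal.ofReal_mul (by positivity),
        mul_one]
      apply ENNReal.ofReal_le_ofReal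
      apply le_of_eq
      rw [Real.rpow_neg hρ.le, Real.rpow_two]
      field_simp
    · simp [h]
  · have hsub : Set.Ici R ⊆ Set.Ioi 0 := fun x hx => hR.trans_le hx
    have e : ∫⁻ ρ in Set.Ioi 0, (Set.Ici R).indicator (fun ρ => ENNReal.ofReal (ρ ^ (-2 : ℝ))) ρ
        = ENNReal.ofReal (1 / R) := by
      rw [lintegral_indicator measurableSet_Ici, Measure.restrict_restrict measurableSet_Ici,
        Set.inter_eq_self_of_subset_left hsub,
        setLIntegral_congr Ioi_ae_eq_Ici.symm]
      rw [← ofReal_integral_eq_lintegral_ofReal, integral_Ioi_rpow_of_lt (by norm_num) hR]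
      · norm_num [Real.rpow_neg_one]
      · exact integrableOn_Ioi_rpow_of_lt (by norm_num) hR
      · filter_upwards [ae_restrict_mem measurableSet_Ioi] with x hx
        have := hR.trans hx
        simp only [Pi.zero_apply]
        positivity
    rw [e, lintegral_one, Measure.restrict_apply MeasurableSet.univ, Set.univ_inter,
      Real.volume_Ioo, ← ENNReal.ofReal_mul (by positivity)]
    apply ENNReal.ofReal_le_ofReal
    apply le_of_eq
    ring

/-! ### Difference quotients of periodic functions -/

theorem ofReal_abs_integral_le (g : ℝ → ℝ) :
    ENNReal.ofReal |∫ t in (0 : ℝ)..1, g t| ≤ ∫⁻ t in Set.Ioc (0 : ℝ) 1, ENNReal.ofReal |g t| := by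
  rw [intervalIntegral.integral_of_le zero_le_one]
  have := enorm_integral_le_lintegral_enorm (μ := volume.restrict (Set.Ioc (0 : ℝ) 1)) g
  simpa only [Real.enorm_eq_ofReal_abs] using this

theorem ofReal_sq_integral_le (g : ℝ → ℝ) (hg : Continuous g) :
    ENNReal.ofReal ((∫ t in (0 : ℝ)..1, g t) ^ 2)
      ≤ ∫⁻ t in Set.Ioc (0 : ℝ) 1, ENNReal.ofReal (g t ^ 2) := by
  set c := ∫ t in (0 : ℝ)..1, g t with hc
  have h1 : 0 ≤ ∫ t in (0 : ℝ)..1, (g t - c) ^ 2 :=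
    intervalIntegral.integral_nonneg zero_le_one fun t _ => sq_nonneg _
  have h2 : ∫ t in (0 : ℝ)..1, (g t - c) ^ 2 = (∫ t in (0 : ℝ)..1, g t ^ 2) - c ^ 2 := by
    have : ∀ t, (g t - c) ^ 2 = g t ^ 2 - (2 * c) * g t + c ^ 2 := fun t => by ring
    simp_rw [this]
    rw [intervalIntegral.integral_add, intervalIntegral.integral_sub,
      intervalIntegral.integral_const_mul, ← hc]
    · simp; ring
    all_goals exact Continuous.intervalIntegrable (by fun_prop) _ _
  have h3 : c ^ 2 ≤ ∫ t in (0 : ℝ)..1, g t ^ 2 := by linarith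
  refine (ENNReal.ofReal_le_ofReal h3).trans ?_
  rw [intervalIntegral.integral_of_le zero_le_one, ofReal_integral_eq_lintegral_ofReal]
  · have : Continuous fun t => g t ^ 2 := by fun_prop
    exact (this.integrableOn_Icc).mono_set Set.Ioc_subset_Icc_self
  · exact Eventually.of_forall fun t => sq_nonneg _

theorem ftc_line (f : R2 → ℝ) (hf : ContDiff ℝ 1 f) (x z : R2) :
    f (x + z) - f x = ∫ t in (0 : ℝ)..1, fderiv ℝ f (x + t • z) z := by
  have hd : ∀ t : ℝ, HasDerivAt (fun t : ℝ => f (x + t • z)) (fderiv ℝ f (x + t • z) z) t := by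
    intro t
    have h1 : HasDerivAt (fun t : ℝ => x + t • z) z t := by
      simpa using ((hasDerivAt_id t).smul_const z).const_add x
    exact ((hf.differentiable (by norm_num)) (x + t • z)).hasFDerivAt.comp_hasDerivAt t h1
  have hc : Continuous fun t : ℝ => fderiv ℝ f (x + t • z) z := by
    have := hf.continuous_fderiv (by norm_num)
    fun_prop
  rw [intervalIntegral.integral_eq_sub_of_hasDerivAt (fun t _ => hd t) (hc.intervalIntegrable _ _)]
  simp

theorem lintegral_line (H : R2 → ENNReal) (hH : Measurable H)
    (hp : ∀ (x : R2) (n : Fin 2 → ℤ), H (x + fun i => (n i : ℝ)) = H x) (z : R2) :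
    ∫⁻ x in cube, ∫⁻ t in Set.Ioc (0 : ℝ) 1, H (x + t • z) = ∫⁻ x in cube, H x := by
  rw [lintegral_lintegral_swap (by fun_prop)]
  simp_rw [lintegral_cube_shift H hp]
  simp

theorem fderiv_periodic (f : R2 → ℝ)
    (hp : ∀ (x : R2) (n : Fin 2 → ℤ), f (x + fun i => (n i : ℝ)) = f x)
    (x : R2) (n : Fin 2 → ℤ) : fderiv ℝ f (x + fun i => (n i : ℝ)) = fderiv ℝ f x := by
  rw [← fderiv_comp_add_right]
  congr 1
  ext y
  exact hp y n

theorem diff_abs_le (f : R2 → ℝ) (hf : ContDiff ℝ 1 f)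
    (hp : ∀ (x : R2) (n : Fin 2 → ℤ), f (x + fun i => (n i : ℝ)) = f x) (z : R2) :
    ∫⁻ x in cube, ENNReal.ofReal |f (x + z) - f x|
      ≤ ∫⁻ x in cube, ENNReal.ofReal |fderiv ℝ f x z| := by
  have := hf.continuous_fderiv (by norm_num)
  rw [← lintegral_line (fun x => ENNReal.ofReal |fderiv ℝ f x z|)
    (Continuous.measurable (by fun_prop)).ennreal_ofReal
    (fun x n => by simp only [fderiv_periodic f hp]) z]
  refine lintegral_mono fun x => ?_
  simp only
  rw [ftc_line f hf]
  exact ofReal_abs_integral_le _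

theorem diff_sq_le (f : R2 → ℝ) (hf : ContDiff ℝ 1 f)
    (hp : ∀ (x : R2) (n : Fin 2 → ℤ), f (x + fun i => (n i : ℝ)) = f x) (z : R2) :
    ∫⁻ x in cube, ENNReal.ofReal ((f (x + z) - f x) ^ 2)
      ≤ ∫⁻ x in cube, ENNReal.ofReal ((fderiv ℝ f x z) ^ 2) := by
  have := hf.continuous_fderiv (by norm_num)
  rw [← lintegral_line (fun x => ENNReal.ofReal ((fderiv ℝ f x z) ^ 2))
    (Continuous.measurable (by fun_prop)).ennreal_ofReal
    (fun x n => by simp only [fderiv_periodic f hp]) z]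
  refine lintegral_mono fun x => ?_
  simp only
  rw [ftc_line f hf]
  exact ofReal_sq_integral_le _ (by fun_prop)

/-! ### The interpolation estimate for the nonlocal term -/

theorem fderiv_apply_two (f : R2 → ℝ) (x z : R2) :
    fderiv ℝ f x z = fderiv ℝ f x (Pi.single 0 1) * z 0 + fderiv ℝ f x (Pi.single 1 1) * z 1 := by
  have : z = z 0 • (Pi.single 0 1 : R2) + z 1 • (Pi.single 1 1 : R2) := by
    ext i; fin_cases i <;> simp
  conv_lhs => rw [this]
  simp only [map_add, map_smul, smul_eq_mul]
  ring

theorem gradNormSq_two (f : R2 → ℝ) (x : R2) :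
    gradNormSq f x = fderiv ℝ f x (Pi.single 0 1) ^ 2 + fderiv ℝ f x (Pi.single 1 1) ^ 2 := by
  simp [gradNormSq]

theorem nonlocal_le (f : R2 → ℝ) (hf : ContDiff ℝ 1 f)
    (hp : ∀ (x : R2) (n : Fin 2 → ℤ), f (x + fun i => (n i : ℝ)) = f x)
    (hb : ∀ x, |f x| ≤ 1) (r R : ℝ) (hr : 0 < r) (hR : r ≤ R) :
    ∫⁻ x in cube, ∫⁻ z : R2, ENNReal.ofReal ((f (x + z) - f x) ^ 2 / en2 z ^ 3)
      ≤ (∫⁻ x in cube, ENNReal.ofReal (π * r * gradNormSq f x))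
        + 2 * (∫⁻ x in cube, ENNReal.ofReal (4 * Real.log (R / r) * gradNorm f x))
        + 4 * ENNReal.ofReal (2 * π / R) := by
  have hdf := hf.continuous_fderiv (by norm_num)
  have hfc := hf.continuous
  have hen := continuous_en2
  have m1 := measurable_kern (Set.Iio r) measurableSet_Iio
  have m2 := measurable_kern (Set.Ico r R) measurableSet_Ico
  have m3 := measurable_kern (Set.Ici R) measurableSet_Ici
  have hm0 : Measurable fun p : R2 × R2 =>
      ENNReal.ofReal ((f (p.1 + p.2) - f p.1) ^ 2 / en2 p.2 ^ 3) := by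
    apply Measurable.ennreal_ofReal
    apply Measurable.div
    · exact Continuous.measurable (by fun_prop)
    · exact Continuous.measurable (by fun_prop)
  have hq2 : Measurable fun p : R2 × R2 => ENNReal.ofReal ((fderiv ℝ f p.1 p.2) ^ 2) :=
    (Continuous.measurable (by fun_prop)).ennreal_ofReal
  have hq1 : Measurable fun p : R2 × R2 => ENNReal.ofReal |fderiv ℝ f p.1 p.2| :=
    (Continuous.measurable (by fun_prop)).ennreal_ofReal
  have hkey : ∀ z : R2, ∫⁻ x in cube, ENNReal.ofReal ((f (x + z) - f x) ^ 2 / en2 z ^ 3)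
      ≤ (∫⁻ x in cube, kern (Set.Iio r) z * ENNReal.ofReal ((fderiv ℝ f x z) ^ 2))
        + 2 * (∫⁻ x in cube, kern (Set.Ico r R) z * ENNReal.ofReal |fderiv ℝ f x z|)
        + 4 * kern (Set.Ici R) z := by
    intro z
    have hz2 : Measurable fun x : R2 => ENNReal.ofReal ((fderiv ℝ f x z) ^ 2) :=
      (Continuous.measurable (by fun_prop)).ennreal_ofReal
    have hz1 : Measurable fun x : R2 => ENNReal.ofReal |fderiv ℝ f x z| :=
      (Continuous.measurable (by fun_prop)).ennreal_ofReal
    have hz0 : Measurable fun x : R2 => ENNReal.ofReal ((f (x + z) - f x) ^ 2) :=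
      (Continuous.measurable (by fun_prop)).ennreal_ofReal
    have hz0' : Measurable fun x : R2 => ENNReal.ofReal |f (x + z) - f x| :=
      (Continuous.measurable (by fun_prop)).ennreal_ofReal
    rw [lintegral_const_mul _ hz2, lintegral_const_mul _ hz1]
    have e : ∀ x, ENNReal.ofReal ((f (x + z) - f x) ^ 2 / en2 z ^ 3)
        = ENNReal.ofReal (1 / en2 z ^ 3) * ENNReal.ofReal ((f (x + z) - f x) ^ 2) := by
      intro x
      rw [← ENNReal.ofReal_mul (by have : 0 ≤ en2 z := Real.sqrt_nonneg _; positivity)]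
      congr 1; ring
    simp_rw [e]
    rw [lintegral_const_mul _ hz0]
    have hd : ∀ x, |f (x + z) - f x| ≤ 2 := fun x => by
      have h1 := abs_le.1 (hb (x + z))
      have h2 := abs_le.1 (hb x)
      rw [abs_le]; constructor <;> linarith
    rcases lt_or_ge (en2 z) r with h1 | h1
    · have : kern (Set.Iio r) z = ENNReal.ofReal (1 / en2 z ^ 3) := by
        rw [kern, Set.indicator_of_mem (show en2 z ∈ Set.Iio r from h1)]
      rw [this, add_assoc]
      refine le_add_right ?_
      exact mul_le_mul_right (diff_sq_le f hf hp z) _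
    rcases lt_or_ge (en2 z) R with h2 | h2
    · have : kern (Set.Ico r R) z = ENNReal.ofReal (1 / en2 z ^ 3) := by
        rw [kern, Set.indicator_of_mem (show en2 z ∈ Set.Ico r R from ⟨h1, h2⟩)]
      rw [this]
      refine le_add_right (le_add_left ?_)
      rw [mul_left_comm]
      gcongr
      refine le_trans ?_ (mul_le_mul_right (diff_abs_le f hf hp z) 2)
      rw [← lintegral_const_mul _ hz0']
      refine lintegral_mono fun x => ?_
      simp only
      rw [← ENNReal.ofReal_ofNat, ← ENNReal.ofReal_mul (by norm_num)]
      apply ENNReal.ofReal_le_ofReal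
      rw [← sq_abs, sq]
      exact mul_le_mul_of_nonneg_right (hd x) (abs_nonneg _)
    · have : kern (Set.Ici R) z = ENNReal.ofReal (1 / en2 z ^ 3) := by
        rw [kern, Set.indicator_of_mem (show en2 z ∈ Set.Ici R from h2)]
      rw [this]
      refine le_add_left ?_
      rw [mul_comm 4]
      gcongr
      calc ∫⁻ x in cube, ENNReal.ofReal ((f (x + z) - f x) ^ 2)
          ≤ ∫⁻ x in cube, 4 := by
            refine lintegral_mono fun x => ?_
            simp only
            rw [← ENNReal.ofReal_ofNat]
            apply ENNReal.ofReal_le_ofReal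
            rw [← sq_abs]
            nlinarith [hd x, abs_nonneg (f (x + z) - f x)]
        _ = 4 := by simp [volume_cube]
  rw [lintegral_lintegral_swap hm0.aemeasurable]
  refine (lintegral_mono hkey).trans ?_
  have hA1 : Measurable fun p : R2 × R2 =>
      kern (Set.Iio r) p.1 * ENNReal.ofReal ((fderiv ℝ f p.2 p.1) ^ 2) :=
    (m1.comp measurable_fst).mul (hq2.comp measurable_swap)
  have hA2 : Measurable fun p : R2 × R2 =>
      kern (Set.Ico r R) p.1 * ENNReal.ofReal |fderiv ℝ f p.2 p.1| :=
    (m2.comp measurable_fst).mul (hq1.comp measurable_swap)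
  rw [lintegral_add_right _ (m3.const_mul 4), lintegral_const_mul _ m3,
    lintegral_add_left (Measurable.lintegral_prod_right' hA1),
    lintegral_const_mul _ (Measurable.lintegral_prod_right' hA2),
    lintegral_lintegral_swap (f := fun z x => kern (Set.Iio r) z *
      ENNReal.ofReal ((fderiv ℝ f x z) ^ 2)) hA1.aemeasurable,
    lintegral_lintegral_swap (f := fun z x => kern (Set.Ico r R) z *
      ENNReal.ofReal |fderiv ℝ f x z|) hA2.aemeasurable]
  gcongr with x x
  · rw [gradNormSq_two]
    refine le_of_eq_of_le (lintegral_congr fun z => ?_) (kern_short r hr _ _)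
    rw [fderiv_apply_two f x z]
  · rw [gradNorm, gradNormSq_two]
    refine le_of_eq_of_le (lintegral_congr fun z => ?_) (kern_mid r R hr hR _ _)
    rw [fderiv_apply_two f x z]
  · exact kern_long R (hr.trans_le hR)

/-! ### The Modica-Mortola bound -/

theorem mm_deriv (u v : Fin 3 → ℝ) (h1 : ∑ i, u i ^ 2 = 1) (h2 : ∑ i, u i * v i = 0) :
    v 2 ^ 2 ≤ (1 - u 2 ^ 2) * ∑ i, v i ^ 2 := by
  simp only [Fin.sum_univ_three] at *
  have e : u 2 * v 2 = -(u 0 * v 0 + u 1 * v 1) := by linarith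
  have h3 : (u 2 * v 2) ^ 2 ≤ (u 0 ^ 2 + u 1 ^ 2) * (v 0 ^ 2 + v 1 ^ 2) := by
    rw [e]; nlinarith [sq_nonneg (u 0 * v 1 - u 1 * v 0)]
  have h4 : u 0 ^ 2 + u 1 ^ 2 = 1 - u 2 ^ 2 := by linarith
  rw [h4] at h3
  nlinarith

theorem mag_gradSq_le (m : R2 → R3) (hm : Mag m) (x : R2) :
    gradNormSq (fun y => m y 2) x ≤ (1 - m x 2 ^ 2) * gradVSq m x := by
  obtain ⟨hc, -, hs⟩ := hm
  have hd : HasFDerivAt m (fderiv ℝ m x) x := ((hc.differentiable (by norm_num)) x).hasFDerivAt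
  have hdi : ∀ i, HasFDerivAt (fun y => m y i)
      ((ContinuousLinearMap.proj (R := ℝ) (φ := fun _ : Fin 3 => ℝ) i).comp (fderiv ℝ m x)) x :=
    hasFDerivAt_pi'.1 hd
  have horth : ∀ w : R2, ∑ i, m x i * fderiv ℝ m x w i = 0 := by
    intro w
    have hsum : HasFDerivAt (fun y => ∑ i, m y i ^ 2) _ x :=
      HasFDerivAt.fun_sum (fun i _ => (hdi i).pow 2)
    have hconst : (fun y => ∑ i, m y i ^ 2) = fun _ => (1 : ℝ) := funext hs
    rw [hconst] at hsum
    have := hsum.unique (hasFDerivAt_const (1 : ℝ) x)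
    have h2 := congrArg (fun T : R2 →L[ℝ] ℝ => T w) this
    simp [Fin.sum_univ_three] at h2
    simp only [Fin.sum_univ_three]
    linarith
  rw [gradNormSq, gradVSq, Finset.mul_sum]
  refine Finset.sum_le_sum fun j _ => ?_
  rw [(hdi 2).fderiv]
  exact mm_deriv (m x) (fderiv ℝ m x (Pi.single j 1)) (hs x) (horth _)

theorem gradVSq_nonneg (m : R2 → R3) (x : R2) : 0 ≤ gradVSq m x :=
  Finset.sum_nonneg fun _ _ => Finset.sum_nonneg fun _ _ => sq_nonneg _

/-- The local energy density. -/
def dens (ε : ℝ) (m : R2 → R3) (x : R2) : ℝ :=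
  ε / 2 * gradVSq m x + (1 - (m x 2) ^ 2) / (2 * ε)

theorem mag_sq_le (m : R2 → R3) (hm : Mag m) (x : R2) : m x 2 ^ 2 ≤ 1 := by
  have := hm.2.2 x
  simp only [Fin.sum_univ_three] at this
  nlinarith [sq_nonneg (m x 0), sq_nonneg (m x 1)]

theorem dens_nonneg (ε : ℝ) (hε : 0 < ε) (m : R2 → R3) (hm : Mag m) (x : R2) :
    0 ≤ dens ε m x := by
  have h1 := mag_sq_le m hm x
  have h2 := gradVSq_nonneg m x
  have h3 : 0 ≤ 1 - m x 2 ^ 2 := by linarith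
  unfold dens
  positivity

theorem gradNorm_le_dens (ε : ℝ) (hε : 0 < ε) (m : R2 → R3) (hm : Mag m) (x : R2) :
    gradNorm (fun y => m y 2) x ≤ dens ε m x := by
  rw [gradNorm]
  refine Real.sqrt_le_iff.2 ⟨dens_nonneg ε hε m hm x, (mag_gradSq_le m hm x).trans ?_⟩
  have : dens ε m x ^ 2 - (1 - m x 2 ^ 2) * gradVSq m x
      = (ε / 2 * gradVSq m x - (1 - (m x 2) ^ 2) / (2 * ε)) ^ 2 := by
    unfold dens; field_simp; ring
  nlinarith [sq_nonneg (ε / 2 * gradVSq m x - (1 - (m x 2) ^ 2) / (2 * ε))]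

theorem gradNormSq_le_dens (ε : ℝ) (hε : 0 < ε) (m : R2 → R3) (hm : Mag m) (x : R2) :
    gradNormSq (fun y => m y 2) x ≤ 2 / ε * dens ε m x := by
  refine (mag_gradSq_le m hm x).trans ?_
  have h1 := mag_sq_le m hm x
  have h2 := gradVSq_nonneg m x
  have h3 : 0 ≤ (1 - m x 2 ^ 2) / ε ^ 2 := div_nonneg (by linarith) (by positivity)
  have e : 2 / ε * dens ε m x = gradVSq m x + (1 - m x 2 ^ 2) / ε ^ 2 := by
    unfold dens; field_simp
  rw [e]
  nlinarith [sq_nonneg (m x 2)]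

theorem integrable_dens (ε : ℝ) (m : R2 → R3) (hm : Mag m) :
    IntegrableOn (dens ε m) cube := by
  have h0 := hm.1.continuous
  have h1 := hm.1.continuous_fderiv (by norm_num)
  have hc : Continuous (dens ε m) := by
    unfold dens gradVSq; fun_prop
  refine (hc.continuousOn.integrableOn_compact
    (isCompact_univ_pi fun _ : Fin 2 => isCompact_Icc (a := (0 : ℝ)) (b := 1))).mono_set ?_
  exact Set.pi_mono fun _ _ => Set.Ico_subset_Icc_self

theorem H12_le (ε : ℝ) (hε : 0 < ε) (m : R2 → R3) (hm : Mag m) (R : ℝ) (hR : ε ≤ R) :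
    H12 (fun x => m x 2) ≤ (1 / 2 + 2 / π * Real.log (R / ε)) * (∫ x in cube, dens ε m x)
      + 2 / R := by
  set f : R2 → ℝ := fun x => m x 2 with hfdef
  set E := ∫ x in cube, dens ε m x with hE
  have hRpos : 0 < R := hε.trans_le hR
  have hE0 : 0 ≤ E := integral_nonneg fun x => dens_nonneg ε hε m hm x
  have hl : 0 ≤ Real.log (R / ε) := Real.log_nonneg (by rw [le_div_iff₀ hε]; linarith)
  have hf : ContDiff ℝ 1 f := (contDiff_pi.1 hm.1) 2
  have hp : ∀ (x : R2) (n : Fin 2 → ℤ), f (x + fun i => (n i : ℝ)) = f x := fun x n => by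
    simp only [hfdef, hm.2.1 x n]
  have hb : ∀ x, |f x| ≤ 1 := fun x => by
    have := mag_sq_le m hm x
    exact abs_le_one_iff_mul_self_le_one.2 (by simpa [sq] using this)
  have hEl : ∀ c : ℝ, 0 ≤ c → ∫⁻ x in cube, ENNReal.ofReal (c * dens ε m x)
      = ENNReal.ofReal (c * E) := by
    intro c hc
    rw [hE, ← integral_const_mul, ofReal_integral_eq_lintegral_ofReal]
    · exact (integrable_dens ε m hm).const_mul c
    · exact Eventually.of_forall fun x => mul_nonneg hc (dens_nonneg ε hε m hm x)
  set S := ∫ x in cube, ∫ z : R2, (f (x + z) - f x) ^ 2 / en2 z ^ 3 with hS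
  have hbound : ENNReal.ofReal S ≤ ENNReal.ofReal
      (2 * π * E + 2 * (4 * Real.log (R / ε) * E) + 4 * (2 * π / R)) := by
    calc ENNReal.ofReal S ≤ ‖S‖ₑ := by
          rw [Real.enorm_eq_ofReal_abs]; exact ENNReal.ofReal_le_ofReal (le_abs_self _)
      _ ≤ ∫⁻ x in cube, ‖∫ z : R2, (f (x + z) - f x) ^ 2 / en2 z ^ 3‖ₑ :=
          enorm_integral_le_lintegral_enorm _
      _ ≤ ∫⁻ x in cube, ∫⁻ z : R2, ENNReal.ofReal ((f (x + z) - f x) ^ 2 / en2 z ^ 3) := by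
          refine lintegral_mono fun x => (enorm_integral_le_lintegral_enorm _).trans ?_
          refine lintegral_mono fun z => ?_
          simp only
          rw [Real.enorm_eq_ofReal_abs, abs_of_nonneg]
          exact div_nonneg (sq_nonneg _) (pow_nonneg (Real.sqrt_nonneg _) _)
      _ ≤ _ := nonlocal_le f hf hp hb ε R hε hR
      _ ≤ (∫⁻ x in cube, ENNReal.ofReal (2 * π * dens ε m x))
        + 2 * (∫⁻ x in cube, ENNReal.ofReal (4 * Real.log (R / ε) * dens ε m x))
        + 4 * ENNReal.ofReal (2 * π / R) := by
          refine add_le_add (add_le_add (lintegral_mono fun x => ENNReal.ofReal_le_ofReal ?_)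
            (mul_le_mul_right (lintegral_mono fun x => ENNReal.ofReal_le_ofReal ?_) _)) le_rfl
          · have := mul_le_mul_of_nonneg_left (gradNormSq_le_dens ε hε m hm x)
              (by positivity : 0 ≤ π * ε)
            refine this.trans (le_of_eq ?_)
            field_simp
          · exact mul_le_mul_of_nonneg_left (gradNorm_le_dens ε hε m hm x) (by positivity)
      _ = _ := by
          rw [hEl _ (by positivity), hEl _ (by positivity), ENNReal.ofReal_add (by positivity)
            (by positivity), ENNReal.ofReal_add (by positivity) (by positivity),
            ENNReal.ofReal_mul (p := 2) (by norm_num), ENNReal.ofReal_mul (p := 4) (by norm_num)]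
          simp
  have hS2 := (ENNReal.ofReal_le_ofReal_iff (by positivity)).1 hbound
  rw [H12]
  change 1 / (4 * π) * S ≤ _
  refine (mul_le_mul_of_nonneg_left hS2 (by positivity)).trans (le_of_eq ?_)
  field_simp
  ring

/-- Lemma `le:F-SUPERcrit-lb`, scaling lower bound: in the
supercritical regime the energy is bounded below by `-C λ ε^{(λ_c-λ)/λ}/|log ε|`. -/
theorem stmt_13 :
    ∃ δ C : ℝ, 0 < δ ∧ 0 < C ∧
      ∀ ε lam : ℝ, 0 < ε → ε < 1 / 2 → π / 2 ≤ lam → lam < δ * |Real.log ε| →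
        ∀ m : R2 → R3, Mag m →
          -C * lam * ε ^ ((π / 2 - lam) / lam) / |Real.log ε| ≤ Fen ε lam m := by
  refine ⟨2, 2 * Real.exp (π / 4), by norm_num, by positivity, ?_⟩
  intro ε lam hε hε2 hlam hlam2 m hm
  have hlog : Real.log ε < 0 := Real.log_neg hε (by linarith)
  have hlam0 : 0 < lam := lt_of_lt_of_le (by positivity) hlam
  set l := |Real.log ε| with hl
  have hl1 : Real.log ε = -l := by rw [hl, abs_of_neg hlog]; ring
  have hl0 : 0 < l := by linarith
  set E := ∫ x in cube, dens ε m x with hE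
  set s := π / 2 * l / lam - π / 4 with hs
  have hs0 : 0 ≤ s := by
    have : 1 / 2 ≤ l / lam := by rw [le_div_iff₀ hlam0]; linarith
    have := mul_le_mul_of_nonneg_left this (by positivity : 0 ≤ π / 2)
    rw [hs, mul_div_assoc]; linarith
  have hR : ε ≤ ε * Real.exp s := le_mul_of_one_le_right hε.le (Real.one_le_exp hs0)
  have hH := H12_le ε hε m hm _ hR
  rw [mul_div_cancel_left₀ _ hε.ne', Real.log_exp, ← hE] at hH
  have e1 : 1 / 2 + 2 / π * s = l / lam := by
    rw [hs]; field_simp; ring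
  have e2 : 2 / (ε * Real.exp s) = 2 * Real.exp (π / 4) * ε ^ ((π / 2 - lam) / lam) := by
    rw [Real.rpow_def_of_pos hε, hl1]
    have : ε = Real.exp (-l) := by rw [← hl1, Real.exp_log hε]
    rw [this, ← Real.exp_add, div_eq_mul_inv, ← Real.exp_neg, mul_assoc, ← Real.exp_add]
    congr 2
    rw [hs]; field_simp; ring
  rw [e1, e2] at hH
  have h2 := mul_le_mul_of_nonneg_left hH (by positivity : 0 ≤ lam / l)
  have e3 : lam / l * (l / lam * E + 2 * Real.exp (π / 4) * ε ^ ((π / 2 - lam) / lam))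
      = E + 2 * Real.exp (π / 4) * lam * ε ^ ((π / 2 - lam) / lam) / l := by
    field_simp
  rw [e3] at h2
  change _ ≤ E - lam / l * H12 (fun x => m x 2)
  have e4 : -(2 * Real.exp (π / 4)) * lam * ε ^ ((π / 2 - lam) / lam) / l
      = -(2 * Real.exp (π / 4) * lam * ε ^ ((π / 2 - lam) / lam) / l) := by ring
  rw [e4]
  linarith
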